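/- Let N ≥ 1 and let m_1, …, m_N be integers with ∑_{j=1}^N m_j = 0 and with all partial sums nonnegative, i.e. ∑_{j=1}^n m_j ≥ 0 for every 1 ≤ n ≤ N. Then there exists an N×N antisymmetric integer matrix M with nonnegative upper entries whose j-th row sum equals m_j for every 1 ≤ j ≤ N. -/

import Mathlib

/-- For `N ≥ 1` and integers `m 1, …, m N` summing to zero with
all partial sums nonnegative, there exists an `N × N` antisymmetric integer
matrix `M` with nonnegative upper entries whose `j`-th row sum equals `m j` for
every `1 ≤ j ≤ N`. -/
theorem stmt_4 (N : ℕ) (hN : 1 ≤ N) (m : ℕ → ℤ)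
    (hsum : ∑ j ∈ Finset.Icc 1 N, m j = 0)
    (hpartial : ∀ n, 1 ≤ n → n ≤ N → 0 ≤ ∑ j ∈ Finset.Icc 1 n, m j) :
    ∃ M : ℕ → ℕ → ℤ,
      (∀ j ∈ Finset.Icc 1 N, ∀ l ∈ Finset.Icc 1 N, M j l = - M l j) ∧
      (∀ j ∈ Finset.Icc 1 N, ∀ l ∈ Finset.Icc 1 N, j < l → 0 ≤ M j l) ∧
      (∀ j ∈ Finset.Icc 1 N, ∑ l ∈ Finset.Icc 1 N, M j l = m j) := by
  set S : ℕ → ℤ := fun n => ∑ j ∈ Finset.Icc 1 n, m j with hS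
  have hS_zero : S 0 = 0 := by simp [hS]
  have hS_succ (n : ℕ) : S (n + 1) = S n + m (n + 1) :=
    Finset.sum_Icc_succ_top (Nat.le_add_left 1 n) m
  refine ⟨fun j l => (if j + 1 = l then S j else 0) - (if l + 1 = j then S l else 0),
    fun j _ l _ => by ring, fun j hj l _ hjl => ?_, fun j hj => ?_⟩
  · obtain ⟨hj1, hjN⟩ := Finset.mem_Icc.mp hj
    have hSj : 0 ≤ S j := hpartial j hj1 hjN
    dsimp only
    rw [if_neg (show ¬ l + 1 = j by omega), sub_zero]
    split_ifs <;> simp [hSj]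
  · obtain ⟨hj1, hjN⟩ := Finset.mem_Icc.mp hj
    obtain ⟨i, rfl⟩ : ∃ i, j = i + 1 := ⟨j - 1, by omega⟩
    have h_right : (if i + 1 + 1 ∈ Finset.Icc 1 N then S (i + 1) else 0) = S (i + 1) := by
      split_ifs with h
      · rfl
      · have hiN : i + 1 = N := by rw [Finset.mem_Icc] at h; omega
        rw [hiN]
        exact hsum.symm
    have h_left : (if i ∈ Finset.Icc 1 N then S i else 0) = S i := by
      split_ifs with h
      · rfl
      · have hi : i = 0 := by rw [Finset.mem_Icc] at h; omega
        rw [hi, hS_zero]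
    simp only [Finset.sum_sub_distrib, add_left_inj, Finset.sum_ite_eq, Finset.sum_ite_eq']
    rw [h_right, h_left, hS_succ]
    ring
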